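/- If a channel q(T|X,Y) from X×Y to T solves the Intertwining Information Bottleneck problem with parameter λ = I(X;Y), then for all (x,y) ∈ S and all t ∈ T, q(t|x,y) = Σ_{j=1}^n q(t|T_j^q) δ_{(x,y) ∈ S_j}, where q(t|T_j^q) := (q(t)/q(T_j^q)) δ_{t ∈ T_j^q}. -/

import Mathlib

noncomputable section

/-- `p` is a probability distribution on the finite set `X × Y`. -/
def IsJointDist {X Y : Type} [Fintype X] [Fintype Y] (p : X → Y → ℝ) : Prop :=
  (∀ x y, 0 ≤ p x y) ∧ (∑ x, ∑ y, p x y) = 1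

/-- Marginal distribution `p(X)`. -/
def margX {X Y : Type} [Fintype Y] (p : X → Y → ℝ) (x : X) : ℝ := ∑ y, p x y

/-- Marginal distribution `p(Y)`. -/
def margY {X Y : Type} [Fintype X] (p : X → Y → ℝ) (y : Y) : ℝ := ∑ x, p x y

/-- Mutual information `I(X;Y) = D(p(X,Y) ‖ p(X)p(Y))`. -/
def miXY {X Y : Type} [Fintype X] [Fintype Y] (p : X → Y → ℝ) : ℝ :=
  ∑ x, ∑ y, p x y * Real.log (p x y / (margX p x * margY p y))

/-- A channel from `A` to the countable bottleneck space `T := ℕ`. -/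
def IsChannelNat {A : Type} (κ : A → ℕ → ℝ) : Prop :=
  (∀ a t, 0 ≤ κ a t) ∧ ∀ a, (∑' t, κ a t) = 1

/-- Pushforward of the distribution `w` on `A` through the channel `κ`. -/
def pushNat {A : Type} [Fintype A] (w : A → ℝ) (κ : A → ℕ → ℝ) (t : ℕ) : ℝ :=
  ∑ a, w a * κ a t

/-- Kullback–Leibler divergence between distributions on `ℕ`. -/
def klNat (u v : ℕ → ℝ) : ℝ := ∑' t, u t * Real.log (u t / v t)

/-- Mutual information between the input (distributed as `w`) and the output of
the channel `κ`, computed from the joint distribution `w(a) κ(t|a)`. -/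
def miNat {A : Type} [Fintype A] (w : A → ℝ) (κ : A → ℕ → ℝ) : ℝ :=
  ∑ a, ∑' t, w a * κ a t * Real.log (κ a t / pushNat w κ t)

/-- The joint distribution `p(X,Y)` as a weight on `X × Y`. -/
def jointW {X Y : Type} (p : X → Y → ℝ) : X × Y → ℝ := fun a => p a.1 a.2

/-- The product of the marginals `p(X)p(Y)` as a weight on `X × Y`. -/
def splitW {X Y : Type} [Fintype X] [Fintype Y] (p : X → Y → ℝ) : X × Y → ℝ :=
  fun a => margX p a.1 * margY p a.2

/-- `κ` solves the Intertwining Information Bottleneck problem with parameter `lam`: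
it is a channel satisfying the constraint `D(κ(p(X,Y)) ‖ κ(p(X)p(Y))) = lam` and it
minimises `I_κ(X,Y;T)` among all channels satisfying this constraint. -/
def SolvesIIB {X Y : Type} [Fintype X] [Fintype Y] (p : X → Y → ℝ)
    (κ : X × Y → ℕ → ℝ) (lam : ℝ) : Prop :=
  IsChannelNat κ ∧
  klNat (pushNat (jointW p) κ) (pushNat (splitW p) κ) = lam ∧
  ∀ κ' : X × Y → ℕ → ℝ, IsChannelNat κ' →
    klNat (pushNat (jointW p) κ') (pushNat (splitW p) κ') = lam →
    miNat (jointW p) κ ≤ miNat (jointW p) κ'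

/-- The ratio `p(x,y)/(p(x)p(y))` whose level sets define the equivalence relation `∼`. -/
def ratio {X Y : Type} [Fintype X] [Fintype Y] (p : X → Y → ℝ) (a : X × Y) : ℝ :=
  p a.1 a.2 / (margX p a.1 * margY p a.2)

/-- A channel `γ` is congruent if distinct inputs have disjoint output supports. -/
def IsCongruentNat {A : Type} (γ : A → ℕ → ℝ) : Prop :=
  ∀ a a', a ≠ a' → Disjoint (Function.support (γ a)) (Function.support (γ a'))

/-- `T_j^q`: the "probabilistic image" of the class `S_j` through the channel `q`,
i.e. the set of `t` achieved with positive probability from some `(x,y) ∈ S_j`. -/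
def TjSet {X Y : Type} {n : ℕ} (p : X → Y → ℝ)
    (idx : X × Y → Fin n) (q : X × Y → ℕ → ℝ) (j : Fin n) : Set ℕ :=
  {t | ∃ a : X × Y, jointW p a ≠ 0 ∧ idx a = j ∧ 0 < q a t}

/-- `q(T_j^q)`: the mass of `T_j^q` under the pushforward `q(T)`. -/
def TjMass {X Y : Type} [Fintype X] [Fintype Y] {n : ℕ} (p : X → Y → ℝ)
    (idx : X × Y → Fin n) (q : X × Y → ℕ → ℝ) (j : Fin n) : ℝ :=
  ∑' t, Set.indicator (TjSet p idx q j) (pushNat (jointW p) q) t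

/-- The channel `γ_q` from `{1,…,n}` to `T`, `γ_q(t|j) = (q(t)/q(T_j^q)) δ_{t ∈ T_j^q}`. -/
def gammaq {X Y : Type} [Fintype X] [Fintype Y] {n : ℕ} (p : X → Y → ℝ)
    (idx : X × Y → Fin n) (q : X × Y → ℕ → ℝ) (j : Fin n) (t : ℕ) : ℝ :=
  Set.indicator (TjSet p idx q j)
    (fun t' => pushNat (jointW p) q t' / TjMass p idx q j) t

theorem sub_le_mul_log_div {x y : ℝ} (hx : 0 ≤ x) (hy : 0 ≤ y) (hxy : y = 0 → x = 0) :
    x - y ≤ x * Real.log (x / y) := by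
  rcases hx.eq_or_lt with rfl | hx
  · simpa using hy
  have hy' : 0 < y := hy.lt_of_ne fun h => hx.ne' (hxy h.symm)
  have h := mul_le_mul_of_nonneg_left (Real.one_sub_inv_le_log_of_pos (div_pos hx hy')) hx.le
  have h' : x * (1 - (x / y)⁻¹) = x - y := by field_simp
  rwa [h'] at h

theorem eq_of_mul_log_div_eq_sub {x y : ℝ} (hx : 0 ≤ x) (hy : 0 ≤ y) (hxy : y = 0 → x = 0)
    (h : x * Real.log (x / y) = x - y) : x = y := by
  rcases hx.eq_or_lt with rfl | hx
  · exact (by simpa using h : y = 0).symm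
  have hy' : 0 < y := hy.lt_of_ne fun h => hx.ne' (hxy h.symm)
  by_contra hne
  have hlt := Real.log_lt_sub_one_of_pos (div_pos hy' hx)
    (fun h1 => hne ((div_eq_one_iff_eq hx.ne').1 h1).symm)
  have hlog : Real.log (y / x) = -Real.log (x / y) := by rw [← Real.log_inv, inv_div]
  have h' : x * (y / x - 1) = y - x := by field_simp
  have := mul_lt_mul_of_pos_left hlt hx
  rw [hlog, h'] at this
  linarith

theorem summable_of_le_of_le {f g h : ℕ → ℝ} (hf : Summable f) (hh : Summable h)
    (hfg : ∀ t, f t ≤ g t) (hgh : ∀ t, g t ≤ h t) : Summable g := by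
  have : Summable fun t => g t - f t :=
    Summable.of_nonneg_of_le (fun t => sub_nonneg.2 (hfg t))
      (fun t => sub_le_sub_right (hgh t) _) (hh.sub hf)
  simpa using this.add hf

theorem hasSum_klNat {f g : ℕ → ℝ} (hf1 : HasSum f 1) (hg1 : HasSum g 1)
    (hs : Summable fun t => f t * Real.log (f t / g t)) :
    HasSum (fun t => f t * Real.log (f t / g t) - (f t - g t)) (klNat f g) := by
  simpa [klNat] using hs.hasSum.sub (hf1.sub hg1)

/-- Gibbs' inequality. -/
theorem klNat_nonneg {f g : ℕ → ℝ} (hf : ∀ t, 0 ≤ f t) (hg : ∀ t, 0 ≤ g t)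
    (hfg : ∀ t, g t = 0 → f t = 0) (hf1 : HasSum f 1) (hg1 : HasSum g 1)
    (hs : Summable fun t => f t * Real.log (f t / g t)) : 0 ≤ klNat f g :=
  (hasSum_klNat hf1 hg1 hs).nonneg fun t =>
    sub_nonneg.2 (sub_le_mul_log_div (hf t) (hg t) (hfg t))

/-- Gibbs' inequality, equality case. -/
theorem eq_of_klNat_eq_zero {f g : ℕ → ℝ} (hf : ∀ t, 0 ≤ f t) (hg : ∀ t, 0 ≤ g t)
    (hfg : ∀ t, g t = 0 → f t = 0) (hf1 : HasSum f 1) (hg1 : HasSum g 1)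
    (hs : Summable fun t => f t * Real.log (f t / g t)) (h : klNat f g = 0) (t : ℕ) :
    f t = g t := by
  have hsum := hasSum_klNat hf1 hg1 hs
  rw [h, hasSum_zero_iff_of_nonneg fun t =>
    sub_nonneg.2 (sub_le_mul_log_div (hf t) (hg t) (hfg t))] at hsum
  exact eq_of_mul_log_div_eq_sub (hf t) (hg t) (hfg t) (sub_eq_zero.1 (congrFun hsum t))

theorem IsChannelNat.hasSum {A : Type} {q : A → ℕ → ℝ} (hq : IsChannelNat q) (a : A) :
    HasSum (q a) 1 := by
  have hs : Summable (q a) := by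
    by_contra hn
    simpa [tsum_eq_zero_of_not_summable hn] using hq.2 a
  simpa [hq.2 a] using hs.hasSum

theorem IsChannelNat.hasSum_sum {A : Type} [Fintype A] {q : A → ℕ → ℝ} (hq : IsChannelNat q)
    (c : A → ℝ) : HasSum (fun t => ∑ a, c a * q a t) (∑ a, c a) := by
  simpa using _root_.hasSum_sum fun a (_ : a ∈ Finset.univ) => (hq.hasSum a).mul_left (c a)

theorem pushNat_nonneg {A : Type} [Fintype A] {w : A → ℝ} {q : A → ℕ → ℝ} (hw : ∀ a, 0 ≤ w a)
    (hq : IsChannelNat q) (t : ℕ) : 0 ≤ pushNat w q t :=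
  Finset.sum_nonneg fun a _ => mul_nonneg (hw a) (hq.1 a t)

theorem mul_le_pushNat {A : Type} [Fintype A] {w : A → ℝ} {q : A → ℕ → ℝ} (hw : ∀ a, 0 ≤ w a)
    (hq : IsChannelNat q) (a : A) (t : ℕ) : w a * q a t ≤ pushNat w q t :=
  Finset.single_le_sum (f := fun a => w a * q a t)
    (fun a _ => mul_nonneg (hw a) (hq.1 a t)) (Finset.mem_univ a)

/-- Equality case of the data processing inequality: a channel that preserves the divergence
only merges inputs with the same likelihood ratio. -/
theorem div_eq_pushNat_div_pushNat {A : Type} [Fintype A] {p w : A → ℝ} (hp : ∀ a, 0 ≤ p a)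
    (hw : ∀ a, 0 < w a) {q : A → ℕ → ℝ} (hq : IsChannelNat q)
    (h : klNat (pushNat p q) (pushNat w q) = ∑ a, p a * Real.log (p a / w a))
    {a : A} {t : ℕ} (hqa : 0 < q a t) :
    p a / w a = pushNat p q t / pushNat w q t := by
  set u := pushNat p q with hu
  set v := pushNat w q with hv
  have hu0 : ∀ t, 0 ≤ u t := pushNat_nonneg hp hq
  have hv0 : ∀ t, 0 ≤ v t := pushNat_nonneg (fun a => (hw a).le) hq
  have hq0 : ∀ a t, v t = 0 → q a t = 0 := fun a t h0 => by
    have h1 : w a * q a t ≤ v t := mul_le_pushNat (fun a => (hw a).le) hq a t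
    rw [h0] at h1
    exact le_antisymm (nonpos_of_mul_nonpos_right h1 (hw a)) (hq.1 a t)
  have huv : ∀ t, v t = 0 → u t = 0 := fun t h0 => by simp [hu, pushNat, hq0 _ t h0]
  have hup : ∀ a t, u t = 0 → p a * q a t = 0 := fun a t h0 =>
    le_antisymm (h0 ▸ mul_le_pushNat hp hq a t) (mul_nonneg (hp a) (hq.1 a t))
  have hy0 : ∀ a t, 0 ≤ w a * q a t * (u t / v t) := fun a t =>
    mul_nonneg (mul_nonneg (hw a).le (hq.1 a t)) (div_nonneg (hu0 t) (hv0 t))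
  have hac : ∀ a t, w a * q a t * (u t / v t) = 0 → p a * q a t = 0 := by
    intro a t h0
    rcases mul_eq_zero.1 h0 with h0 | h0
    · simp [(mul_eq_zero.1 h0).resolve_left (hw a).ne']
    · rcases div_eq_zero_iff.1 h0 with h0 | h0
      · exact hup a t h0
      · simp [hq0 a t h0]
  have hlog : ∀ a t, p a * q a t * Real.log (p a * q a t / (w a * q a t * (u t / v t))) =
      p a * Real.log (p a / w a) * q a t - p a * q a t * Real.log (u t / v t) := by
    intro a t
    by_cases h0 : p a * q a t = 0
    · rw [show p a * Real.log (p a / w a) * q a t = p a * q a t * Real.log (p a / w a) by ring]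
      simp [h0]
    have hpa : p a ≠ 0 := left_ne_zero_of_mul h0
    have hqa : q a t ≠ 0 := right_ne_zero_of_mul h0
    have huv0 : u t / v t ≠ 0 := fun h1 => h0 (hac a t (by simp [h1]))
    rw [show p a * q a t / (w a * q a t * (u t / v t)) = p a / w a / (u t / v t) by
      field_simp, Real.log_div (div_ne_zero hpa (hw a).ne') huv0]
    ring
  have hd : ∀ a t, 0 ≤ p a * Real.log (p a / w a) * q a t - p a * q a t * Real.log (u t / v t)
      - (p a * q a t - w a * q a t * (u t / v t)) := fun a t => by
    rw [← hlog]
    exact sub_nonneg.2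
      (sub_le_mul_log_div (mul_nonneg (hp a) (hq.1 a t)) (hy0 a t) (hac a t))
  have hdsum : ∀ t, ∑ a, (p a * Real.log (p a / w a) * q a t
      - p a * q a t * Real.log (u t / v t) - (p a * q a t - w a * q a t * (u t / v t))) =
      ∑ a, p a * Real.log (p a / w a) * q a t - u t * Real.log (u t / v t) := by
    intro t
    simp only [Finset.sum_sub_distrib, ← Finset.sum_mul]
    change _ - u t * _ - (u t - v t * _) = _
    rw [mul_div_cancel_of_imp' (huv t)]
    ring
  have hnn : ∀ t, 0 ≤ ∑ a, p a * Real.log (p a / w a) * q a t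
      - u t * Real.log (u t / v t) := fun t =>
    hdsum t ▸ Finset.sum_nonneg fun a _ => hd a t
  have hI := hq.hasSum_sum fun a => p a * Real.log (p a / w a)
  have hkl : Summable fun t => u t * Real.log (u t / v t) :=
    summable_of_le_of_le ((hq.hasSum_sum p).sub (hq.hasSum_sum w)).summable hI.summable
      (fun t => sub_le_mul_log_div (hu0 t) (hv0 t) (huv t)) (fun t => sub_nonneg.1 (hnn t))
  have hz := hI.sub hkl.hasSum
  rw [← h, klNat, sub_self, hasSum_zero_iff_of_nonneg hnn] at hz
  have hzt := congrFun hz t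
  simp only [Pi.zero_apply] at hzt
  rw [← hdsum, Finset.sum_eq_zero_iff_of_nonneg fun a _ => hd a t] at hzt
  have hza := hzt a (Finset.mem_univ a)
  rw [← hlog, sub_eq_zero] at hza
  have he := eq_of_mul_log_div_eq_sub (mul_nonneg (hp a) (hq.1 a t)) (hy0 a t) (hac a t) hza
  have hw' := (hw a).ne'
  rw [div_eq_iff hw']
  apply mul_right_cancel₀ hqa.ne'
  linarith

section Classes

variable {X Y : Type} [Fintype X] [Fintype Y] {p : X → Y → ℝ} {n : ℕ} {idx : X × Y → Fin n}
  {q : X × Y → ℕ → ℝ}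

/-- The mass `p(S_j)` of the class `S_j`. -/
def classMass (p : X → Y → ℝ) (idx : X × Y → Fin n) (j : Fin n) : ℝ :=
  ∑ a, if idx a = j then jointW p a else 0

theorem classMass_pos (hp : ∀ a, 0 ≤ jointW p a) {a : X × Y} (ha : jointW p a ≠ 0) :
    0 < classMass p idx (idx a) := by
  refine Finset.sum_pos' (fun b _ => ?_) ⟨a, Finset.mem_univ a, ?_⟩
  · split_ifs
    exacts [hp b, le_rfl]
  · simpa using (hp a).lt_of_ne' ha

theorem indicator_TjSet_pushNat (hq : IsChannelNat q)
    (hdisj : ∀ a b t, jointW p a ≠ 0 → jointW p b ≠ 0 → 0 < q a t → 0 < q b t → idx a = idx b)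
    (j : Fin n) (t : ℕ) :
    Set.indicator (TjSet p idx q j) (pushNat (jointW p) q) t =
      ∑ a, (if idx a = j then jointW p a else 0) * q a t := by
  by_cases ht : t ∈ TjSet p idx q j
  · rw [Set.indicator_of_mem ht]
    obtain ⟨b, hb, rfl, hbt⟩ := ht
    refine Finset.sum_congr rfl fun a _ => ?_
    split_ifs with h
    · rfl
    · by_cases ha : jointW p a = 0
      · simp [ha]
      have : q a t = 0 := by
        by_contra hqa
        exact h (hdisj a b t ha hb ((hq.1 a t).lt_of_ne' hqa) hbt)
      simp [this]
  · rw [Set.indicator_of_notMem ht, eq_comm]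
    refine Finset.sum_eq_zero fun a _ => ?_
    split_ifs with h
    · by_cases ha : jointW p a = 0
      · simp [ha]
      have : q a t = 0 := by
        by_contra hqa
        exact ht ⟨a, ha, h, (hq.1 a t).lt_of_ne' hqa⟩
      simp [this]
    · simp

theorem TjMass_eq_classMass (hq : IsChannelNat q)
    (hdisj : ∀ a b t, jointW p a ≠ 0 → jointW p b ≠ 0 → 0 < q a t → 0 < q b t → idx a = idx b)
    (j : Fin n) : TjMass p idx q j = classMass p idx j := by
  simp only [TjMass, indicator_TjSet_pushNat hq hdisj]
  exact (hq.hasSum_sum _).tsum_eq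

theorem gammaq_eq (hq : IsChannelNat q)
    (hdisj : ∀ a b t, jointW p a ≠ 0 → jointW p b ≠ 0 → 0 < q a t → 0 < q b t → idx a = idx b)
    (j : Fin n) (t : ℕ) :
    gammaq p idx q j t =
      (∑ a, (if idx a = j then jointW p a else 0) * q a t) / classMass p idx j := by
  rw [← indicator_TjSet_pushNat hq hdisj, ← TjMass_eq_classMass hq hdisj, gammaq]
  by_cases ht : t ∈ TjSet p idx q j <;> simp [ht]

theorem gammaq_nonneg (hp : ∀ a, 0 ≤ jointW p a) (hq : IsChannelNat q)
    (hdisj : ∀ a b t, jointW p a ≠ 0 → jointW p b ≠ 0 → 0 < q a t → 0 < q b t → idx a = idx b)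
    (j : Fin n) (t : ℕ) : 0 ≤ gammaq p idx q j t := by
  have h : ∀ a, 0 ≤ if idx a = j then jointW p a else 0 := fun a => by
    split_ifs
    exacts [hp a, le_rfl]
  rw [gammaq_eq hq hdisj]
  exact div_nonneg (Finset.sum_nonneg fun a _ => mul_nonneg (h a) (hq.1 a t))
    (Finset.sum_nonneg fun a _ => h a)

theorem hasSum_gammaq (hp : ∀ a, 0 ≤ jointW p a) (hq : IsChannelNat q)
    (hdisj : ∀ a b t, jointW p a ≠ 0 → jointW p b ≠ 0 → 0 < q a t → 0 < q b t → idx a = idx b)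
    {a : X × Y} (ha : jointW p a ≠ 0) : HasSum (gammaq p idx q (idx a)) 1 := by
  have h := (hq.hasSum_sum fun b => if idx b = idx a then jointW p b else 0).div_const
    (classMass p idx (idx a))
  simp only [← gammaq_eq hq hdisj] at h
  rwa [← classMass, div_self (classMass_pos hp ha).ne'] at h

open Classical in
/-- The channel that agrees with `q` outside the support of `p`, and with `γ_q` on it. -/
def classAverage (p : X → Y → ℝ) (idx : X × Y → Fin n) (q : X × Y → ℕ → ℝ) :
    X × Y → ℕ → ℝ :=
  fun a => if jointW p a = 0 then q a else gammaq p idx q (idx a)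

theorem classAverage_of_ne {a : X × Y} (ha : jointW p a ≠ 0) :
    classAverage p idx q a = gammaq p idx q (idx a) := if_neg ha

theorem isChannelNat_classAverage (hp : ∀ a, 0 ≤ jointW p a) (hq : IsChannelNat q)
    (hdisj : ∀ a b t, jointW p a ≠ 0 → jointW p b ≠ 0 → 0 < q a t → 0 < q b t → idx a = idx b) :
    IsChannelNat (classAverage p idx q) := by
  refine ⟨fun a t => ?_, fun a => ?_⟩ <;> unfold classAverage <;> split_ifs with h
  exacts [hq.1 a t, gammaq_nonneg hp hq hdisj _ t, hq.2 a, (hasSum_gammaq hp hq hdisj h).tsum_eq]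

/-- Averaging over classes preserves sums against weights `c · p` with `c` constant on classes. -/
theorem sum_mul_classAverage (hp : ∀ a, 0 ≤ jointW p a) (hq : IsChannelNat q)
    (hdisj : ∀ a b t, jointW p a ≠ 0 → jointW p b ≠ 0 → 0 < q a t → 0 < q b t → idx a = idx b)
    (c : Fin n → ℝ) (t : ℕ) :
    ∑ a, c (idx a) * (jointW p a * classAverage p idx q a t) =
      ∑ a, c (idx a) * (jointW p a * q a t) := by
  have h1 : ∀ j, classMass p idx j * gammaq p idx q j t =
      ∑ a, (if idx a = j then jointW p a else 0) * q a t := fun j => by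
    rw [gammaq_eq hq hdisj]
    refine mul_div_cancel_of_imp' fun h0 => ?_
    refine Finset.sum_eq_zero fun a _ => ?_
    split_ifs with h
    · subst h
      rw [show jointW p a = 0 by
        by_contra ha
        exact (classMass_pos hp ha).ne' h0, zero_mul]
    · simp
  have h2 : ∀ f : X × Y → ℝ, ∑ a, c (idx a) * f a =
      ∑ j, c j * ∑ a, if idx a = j then f a else 0 := fun f => by
    simp only [Finset.mul_sum]
    rw [Finset.sum_comm]
    simp
  rw [h2, h2]
  refine Finset.sum_congr rfl fun j _ => ?_
  congr 1
  calc ∑ a, (if idx a = j then jointW p a * classAverage p idx q a t else 0)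
      = ∑ a, (if idx a = j then jointW p a else 0) * gammaq p idx q j t := by
        refine Finset.sum_congr rfl fun a _ => ?_
        split_ifs with h
        · by_cases ha : jointW p a = 0
          · simp [ha]
          · rw [classAverage_of_ne ha, h]
        · simp
    _ = ∑ a, (if idx a = j then jointW p a else 0) * q a t := by
        rw [← Finset.sum_mul, ← h1, classMass]
    _ = _ := by simp [ite_mul]

theorem pushNat_jointW_classAverage (hp : ∀ a, 0 ≤ jointW p a) (hq : IsChannelNat q)
    (hdisj : ∀ a b t, jointW p a ≠ 0 → jointW p b ≠ 0 → 0 < q a t → 0 < q b t →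
      idx a = idx b) :
    pushNat (jointW p) (classAverage p idx q) = pushNat (jointW p) q := by
  funext t
  simpa [pushNat] using sum_mul_classAverage hp hq hdisj (fun _ => 1) t

theorem pushNat_classAverage {w : X × Y → ℝ} (hp : ∀ a, 0 ≤ jointW p a) (hq : IsChannelNat q)
    (hdisj : ∀ a b t, jointW p a ≠ 0 → jointW p b ≠ 0 → 0 < q a t → 0 < q b t → idx a = idx b)
    (c : Fin n → ℝ) (hc : ∀ a, jointW p a ≠ 0 → w a = c (idx a) * jointW p a) :
    pushNat w (classAverage p idx q) = pushNat w q := by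
  funext t
  have h : ∀ a, w a * classAverage p idx q a t - w a * q a t =
      c (idx a) * (jointW p a * classAverage p idx q a t)
        - c (idx a) * (jointW p a * q a t) := fun a => by
    by_cases ha : jointW p a = 0
    · simp [classAverage, ha]
    · rw [hc a ha]
      ring
  rw [← sub_eq_zero, pushNat, pushNat, ← Finset.sum_sub_distrib]
  simp only [h]
  rw [Finset.sum_sub_distrib, sum_mul_classAverage hp hq hdisj, sub_self]

end Classes

/-- If `q(T|X,Y)` solves the Intertwining Information Bottleneck
problem with parameter `λ = I(X;Y)`, then for every `(x,y) ∈ S` and every `t`,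
`q(t|x,y) = ∑_{j=1}^n q(t|T_j^q) δ_{(x,y) ∈ S_j}`, where
`q(t|T_j^q) = (q(t)/q(T_j^q)) δ_{t ∈ T_j^q}` is the channel `γ_q`. -/
theorem iib_solution_factorises {X Y : Type} [Fintype X] [Fintype Y]
    (p : X → Y → ℝ) (hp : IsJointDist p)
    (hX : ∀ x, margX p x ≠ 0) (hY : ∀ y, margY p y ≠ 0)
    (n : ℕ) (idx : X × Y → Fin n)
    (hsurj : ∀ j : Fin n, ∃ a : X × Y, jointW p a ≠ 0 ∧ idx a = j)
    (hidx : ∀ a b : X × Y, jointW p a ≠ 0 → jointW p b ≠ 0 →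
      (idx a = idx b ↔ ratio p a = ratio p b))
    (q : X × Y → ℕ → ℝ) (hsol : SolvesIIB p q (miXY p)) :
    ∀ a : X × Y, jointW p a ≠ 0 → ∀ t : ℕ,
      q a t = ∑ j : Fin n, gammaq p idx q j t * (if idx a = j then 1 else 0) := by
  obtain ⟨hq, hkl, hmin⟩ := hsol
  have hp0 : ∀ a, 0 ≤ jointW p a := fun a => hp.1 a.1 a.2
  have hw : ∀ a, 0 < splitW p a := fun a => mul_pos
    ((Finset.sum_nonneg fun y _ => hp.1 a.1 y).lt_of_ne' (hX a.1))
    ((Finset.sum_nonneg fun x _ => hp.1 x a.2).lt_of_ne' (hY a.2))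
  have hmi : miXY p = ∑ a, jointW p a * Real.log (jointW p a / splitW p a) := by
    simp only [miXY, jointW, splitW, Fintype.sum_prod_type]
  have hdisj : ∀ a b t, jointW p a ≠ 0 → jointW p b ≠ 0 → 0 < q a t → 0 < q b t →
      idx a = idx b := fun a b t ha hb hat hbt => by
    have h := hkl.trans hmi
    exact (hidx a b ha hb).2 ((div_eq_pushNat_div_pushNat hp0 hw hq h hat).trans
      (div_eq_pushNat_div_pushNat hp0 hw hq h hbt).symm)
  choose s hs hsj using hsurj
  have hpush := pushNat_jointW_classAverage hp0 hq hdisj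
  have hsplit : pushNat (splitW p) (classAverage p idx q) = pushNat (splitW p) q := by
    refine pushNat_classAverage hp0 hq hdisj (fun j => (ratio p (s j))⁻¹) fun a ha => ?_
    rw [(hidx _ a (hs _) ha).1 (hsj _)]
    change _ = (jointW p a / splitW p a)⁻¹ * jointW p a
    rw [inv_div, div_mul_cancel₀ _ ha]
  have hle := hmin (classAverage p idx q) (isChannelNat_classAverage hp0 hq hdisj)
    (by rw [hpush, hsplit, hkl])
  have hac : ∀ a, jointW p a ≠ 0 → ∀ t, gammaq p idx q (idx a) t = 0 → q a t = 0 := by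
    intro a ha t h0
    by_contra hqa
    have hqa' := (hq.1 a t).lt_of_ne' hqa
    have hmem : t ∈ TjSet p idx q (idx a) := ⟨a, ha, rfl, hqa'⟩
    rw [gammaq, Set.indicator_of_mem hmem, TjMass_eq_classMass hq hdisj] at h0
    have h1 := mul_le_pushNat hp0 hq a t
    have h2 := mul_pos ((hp0 a).lt_of_ne' ha) hqa'
    exact (div_pos (h2.trans_le h1) (classMass_pos hp0 ha)).ne' h0
  have hlogγ : ∀ a, jointW p a ≠ 0 → ∀ t, gammaq p idx q (idx a) t ≠ 0 →
      gammaq p idx q (idx a) t = pushNat (jointW p) q t / classMass p idx (idx a) ∧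
        pushNat (jointW p) q t ≠ 0 := by
    intro a ha t h0
    have hmem : t ∈ TjSet p idx q (idx a) := by
      by_contra hmem
      exact h0 (Set.indicator_of_notMem hmem _)
    have h1 : gammaq p idx q (idx a) t = pushNat (jointW p) q t / classMass p idx (idx a) := by
      rw [gammaq, Set.indicator_of_mem hmem, TjMass_eq_classMass hq hdisj]
    exact ⟨h1, fun h2 => h0 (by rw [h1, h2, zero_div])⟩
  have hterm : ∀ a, jointW p a ≠ 0 → ∀ t,
      jointW p a * q a t * Real.log (q a t / pushNat (jointW p) q t) =
      jointW p a * (q a t * Real.log (q a t / gammaq p idx q (idx a) t))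
        + jointW p a * -Real.log (classMass p idx (idx a)) * q a t := by
    intro a ha t
    by_cases h0 : q a t = 0
    · simp [h0]
    obtain ⟨h1, h2⟩ := hlogγ a ha t fun h => h0 (hac a ha t h)
    have hP := (classMass_pos (idx := idx) hp0 ha).ne'
    rw [h1, div_div_eq_mul_div, mul_div_right_comm,
      Real.log_mul (div_ne_zero h0 h2) hP]
    ring
  have hsumm : ∀ a, jointW p a ≠ 0 →
      Summable fun t => q a t * Real.log (q a t / gammaq p idx q (idx a) t) := by
    intro a ha
    have hpa := (hp0 a).lt_of_ne' ha
    have hP := classMass_pos (idx := idx) hp0 ha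
    refine summable_of_le_of_le
      ((hq.hasSum a).sub (hasSum_gammaq hp0 hq hdisj ha)).summable
      ((hq.hasSum a).mul_right (Real.log (classMass p idx (idx a) / jointW p a))).summable
      (fun t => sub_le_mul_log_div (hq.1 a t) (gammaq_nonneg hp0 hq hdisj _ t) (hac a ha t))
      fun t => ?_
    by_cases h0 : q a t = 0
    · simp [h0]
    have hqa := (hq.1 a t).lt_of_ne' h0
    obtain ⟨h1, h2⟩ := hlogγ a ha t fun h => h0 (hac a ha t h)
    have hu := (pushNat_nonneg hp0 hq t).lt_of_ne' h2
    refine mul_le_mul_of_nonneg_left (Real.log_le_log ?_ ?_) hqa.le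
    · rw [h1]
      positivity
    · rw [h1, div_div_eq_mul_div, div_le_div_iff₀ hu hpa]
      have := mul_le_mul_of_nonneg_right (mul_le_pushNat hp0 hq a t) hP.le
      linarith
  have hmi_q : miNat (jointW p) q = ∑ a, (jointW p a * klNat (q a) (gammaq p idx q (idx a))
      + jointW p a * -Real.log (classMass p idx (idx a))) := by
    refine Finset.sum_congr rfl fun a _ => ?_
    by_cases ha : jointW p a = 0
    · simp [ha]
    simp only [hterm a ha]
    simpa [klNat] using (((hsumm a ha).hasSum.mul_left (jointW p a)).add
      ((hq.hasSum a).mul_left (jointW p a * -Real.log (classMass p idx (idx a))))).tsum_eq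
  have hmi_avg : miNat (jointW p) (classAverage p idx q) =
      ∑ a, jointW p a * -Real.log (classMass p idx (idx a)) := by
    refine Finset.sum_congr rfl fun a _ => ?_
    by_cases ha : jointW p a = 0
    · simp [ha]
    rw [hpush, classAverage_of_ne ha]
    have h : ∀ t, jointW p a * gammaq p idx q (idx a) t *
        Real.log (gammaq p idx q (idx a) t / pushNat (jointW p) q t) =
        jointW p a * -Real.log (classMass p idx (idx a)) * gammaq p idx q (idx a) t := by
      intro t
      by_cases h0 : gammaq p idx q (idx a) t = 0
      · simp [h0]
      obtain ⟨h1, h2⟩ := hlogγ a ha t h0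
      rw [show gammaq p idx q (idx a) t / pushNat (jointW p) q t =
        (classMass p idx (idx a))⁻¹ by rw [h1]; field_simp, Real.log_inv]
      ring
    simp only [h]
    simpa using ((hasSum_gammaq hp0 hq hdisj ha).mul_left
      (jointW p a * -Real.log (classMass p idx (idx a)))).tsum_eq
  rw [hmi_q, hmi_avg, Finset.sum_add_distrib, add_le_iff_nonpos_left] at hle
  have hkl0 : ∀ a, 0 ≤ jointW p a * klNat (q a) (gammaq p idx q (idx a)) := by
    intro a
    by_cases ha : jointW p a = 0
    · simp [ha]
    refine mul_nonneg (hp0 a) ?_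
    exact klNat_nonneg (hq.1 a) (gammaq_nonneg hp0 hq hdisj _) (hac a ha)
      (hq.hasSum a) (hasSum_gammaq hp0 hq hdisj ha) (hsumm a ha)
  intro a ha t
  have hz := (Finset.sum_eq_zero_iff_of_nonneg fun a _ => hkl0 a).1
    (le_antisymm hle (Finset.sum_nonneg fun a _ => hkl0 a)) a (Finset.mem_univ a)
  have heq := eq_of_klNat_eq_zero (hq.1 a) (gammaq_nonneg hp0 hq hdisj _) (hac a ha)
    (hq.hasSum a) (hasSum_gammaq hp0 hq hdisj ha) (hsumm a ha)
    ((mul_eq_zero.1 hz).resolve_left ha) t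
  simpa using heq
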